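/- Let E denote the real vector space of all self-adjoint degree-2 endomorphisms of H. The set of γ ∈ E satisfying the Hodge–Riemann bilinear relations is an open subset of E (in its standard finite-dimensional topology), and it is stable under multiplication by positive real scalars: if γ satisfies the Hodge–Riemann bilinear relations then so does cγ for every real c > 0. -/

import Mathlib

/-- `γ : V → V` is a degree-2 map with respect to the grading `H`: it sends `H^i` into
`H^{i+2}` for every `i`. -/
def IsDegTwo {V : Type} [AddCommGroup V] [Module ℝ V]
    (H : ℤ → Submodule ℝ V) (γ : V → V) : Prop :=
  ∀ i : ℤ, ∀ x ∈ H i, γ x ∈ H (i + 2)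

/-- `γ` satisfies hard Lefschetz with respect to the grading `H`: for every `i ≥ 0` the
`i`-fold composite `γ^i` restricts to a linear isomorphism `H^{-i} → H^i` (expressed as:
every `y ∈ H^i` has a unique preimage in `H^{-i}` under `γ^i`). -/
def HardLefschetz {V : Type} [AddCommGroup V] [Module ℝ V]
    (H : ℤ → Submodule ℝ V) (γ : V → V) : Prop :=
  ∀ i : ℕ, ∀ y ∈ H (i : ℤ), ∃! x, x ∈ H (-(i : ℤ)) ∧ γ^[i] x = y

/-- `B` is a Lefschetz form on the graded vector space `H`: a nondegenerate symmetric
bilinear form with `⟨H^i, H^j⟩ = 0` whenever `i + j ≠ 0`. -/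
def IsLefschetzForm {V : Type} [AddCommGroup V] [Module ℝ V]
    (H : ℤ → Submodule ℝ V) (B : V →ₗ[ℝ] V →ₗ[ℝ] ℝ) : Prop :=
  (∀ x y : V, B x y = B y x) ∧
  (∀ x : V, (∀ y : V, B x y = 0) → x = 0) ∧
  ∀ i j : ℤ, i + j ≠ 0 → ∀ x ∈ H i, ∀ y ∈ H j, B x y = 0


/-- `γ` satisfies the Hodge–Riemann bilinear relations with respect to the Lefschetz form
`B` and minimal degree `m`: for every `i ≥ 0` with `H^{-i} ≠ 0`, the restriction of
`(h, h')_γ^{-i} := ⟨h, γ^i h'⟩` to the primitive subspace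
`P_γ^{-i} := ker(γ^{i+1}) ∩ H^{-i}` is positive definite if `(−i−m)/2` is even and
negative definite if `(−i−m)/2` is odd. -/
def HodgeRiemann {V : Type} [AddCommGroup V] [Module ℝ V]
    (H : ℤ → Submodule ℝ V) (B : V →ₗ[ℝ] V →ₗ[ℝ] ℝ) (m : ℤ) (γ : V → V) : Prop :=
  ∀ i : ℕ, H (-(i : ℤ)) ≠ ⊥ →
    (Even ((-(i : ℤ) - m) / 2) →
      ∀ x ∈ H (-(i : ℤ)), γ^[i + 1] x = 0 → x ≠ 0 → 0 < B x (γ^[i] x)) ∧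
    (¬ Even ((-(i : ℤ) - m) / 2) →
      ∀ x ∈ H (-(i : ℤ)), γ^[i + 1] x = 0 → x ≠ 0 → B x (γ^[i] x) < 0)

theorem hr_iterate_smul {V : Type} [NormedAddCommGroup V] [NormedSpace ℝ V]
    (γ : V →L[ℝ] V) (c : ℝ) (n : ℕ) (x : V) : (⇑(c • γ))^[n] x = c ^ n • (⇑γ)^[n] x := by
  induction n with
  | zero => simp
  | succ k ih =>
    rw [Function.iterate_succ_apply', Function.iterate_succ_apply', ih]
    simp [smul_smul, pow_succ, mul_comm]

theorem hr_iterate_cont {V : Type} [NormedAddCommGroup V] [NormedSpace ℝ V] (n : ℕ) :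
    Continuous fun p : (V →L[ℝ] V) × V => (⇑p.1)^[n] p.2 := by
  induction n with
  | zero => simpa using continuous_snd
  | succ k ih =>
    simp only [Function.iterate_succ_apply']
    exact continuous_fst.clm_apply ih

theorem hr_local {V : Type} [NormedAddCommGroup V] [NormedSpace ℝ V] [FiniteDimensional ℝ V]
    (W : Submodule ℝ V) (B : V →ₗ[ℝ] V →ₗ[ℝ] ℝ) (i : ℕ) (s : ℝ) (γ₀ : V →L[ℝ] V)
    (h : ∀ x ∈ W, (⇑γ₀)^[i + 1] x = 0 → x ≠ 0 → 0 < s * B x ((⇑γ₀)^[i] x)) :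
    ∀ᶠ γ : V →L[ℝ] V in nhds γ₀,
      ∀ x ∈ W, (⇑γ)^[i + 1] x = 0 → x ≠ 0 → 0 < s * B x ((⇑γ)^[i] x) := by
  have : ProperSpace V := FiniteDimensional.proper ℝ V
  have hK : IsCompact (Metric.sphere (0 : V) 1 ∩ (W : Set V)) :=
    (isCompact_sphere 0 1).inter_right W.closed_of_finiteDimensional
  have hBc : Continuous fun p : V × V => B p.1 p.2 := by
    have h1 : Continuous fun v : V => LinearMap.toContinuousLinearMap (B v) :=
      (LinearMap.toContinuousLinearMap.toLinearMap ∘ₗ B).continuous_of_finiteDimensional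
    exact (h1.comp continuous_fst).clm_apply continuous_snd
  have hc1 := hr_iterate_cont (V := V) (i + 1)
  have hc2 : Continuous fun p : (V →L[ℝ] V) × V => s * B p.2 ((⇑p.1)^[i] p.2) :=
    continuous_const.mul (hBc.comp (continuous_snd.prodMk (hr_iterate_cont i)))
  have key := hK.eventually_forall_of_forall_eventually (x₀ := γ₀)
    (P := fun (γ : V →L[ℝ] V) x => (⇑γ)^[i + 1] x ≠ 0 ∨ 0 < s * B x ((⇑γ)^[i] x)) (by
      rintro y ⟨hy1, hyW⟩
      have ho : IsOpen {p : (V →L[ℝ] V) × V |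
          (⇑p.1)^[i + 1] p.2 ≠ 0 ∨ 0 < s * B p.2 ((⇑p.1)^[i] p.2)} :=
        (isOpen_ne_fun hc1 continuous_const).union (isOpen_lt continuous_const hc2)
      have hy0 : y ≠ 0 := by
        rintro rfl
        simp at hy1
      refine ho.mem_nhds ?_
      by_cases h0 : (⇑γ₀)^[i + 1] y = 0
      · exact Or.inr (h y hyW h0 hy0)
      · exact Or.inl h0)
  filter_upwards [key] with γ hγ x hxW hx0 hxne
  have hn : 0 < ‖x‖ := norm_pos_iff.mpr hxne
  have hit : ∀ n, (⇑γ)^[n] (‖x‖⁻¹ • x) = ‖x‖⁻¹ • (⇑γ)^[n] x := by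
    intro n
    induction n with
    | zero => simp
    | succ k ih => rw [Function.iterate_succ_apply', Function.iterate_succ_apply', ih, map_smul]
  have := hγ (‖x‖⁻¹ • x) ⟨by simp [norm_smul, hn.ne'], W.smul_mem _ hxW⟩
  rw [hit, hit, hx0, smul_zero] at this
  rcases this with h1 | h1
  · exact absurd rfl h1
  · have h2 : s * B (‖x‖⁻¹ • x) (‖x‖⁻¹ • (⇑γ)^[i] x)
        = (‖x‖⁻¹ * ‖x‖⁻¹) * (s * B x ((⇑γ)^[i] x)) := by
      simp only [map_smul, LinearMap.smul_apply, smul_eq_mul]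
      ring
    rw [h2] at h1
    exact (pos_iff_pos_of_mul_pos h1).mp (by positivity)

/-- **The Hodge–Riemann maps form an open cone.** Let `H` be a nonzero finite-dimensional
graded real vector space concentrated in degrees congruent to the minimal degree `m`
modulo 2, with a Lefschetz form `B`, and let `E` be the space of self-adjoint degree-2
endomorphisms of `H` (realised as continuous linear maps; in finite dimension every
linear map is continuous, and the topology is the standard one). Then the set of `γ ∈ E`
satisfying the Hodge–Riemann bilinear relations is open in `E`, and it is stable under
multiplication by positive real scalars. -/
theorem hodgeRiemann_isOpen_and_posScalar_stable
    {V : Type} [NormedAddCommGroup V] [NormedSpace ℝ V] [FiniteDimensional ℝ V]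
    (H : ℤ → Submodule ℝ V) (hint : DirectSum.IsInternal H)
    (m : ℤ) (hm : H m ≠ ⊥) (hmin : ∀ j : ℤ, j < m → H j = ⊥)
    (hpar : ∀ i : ℤ, ¬ Even (i - m) → H i = ⊥)
    (B : V →ₗ[ℝ] V →ₗ[ℝ] ℝ) (hB : IsLefschetzForm H B) :
    IsOpen {γ : {g : V →L[ℝ] V // IsDegTwo H ⇑g ∧ ∀ x y : V, B (g x) y = B x (g y)} |
      HodgeRiemann H B m ⇑(γ.1)} ∧
    ∀ γ : V →L[ℝ] V, IsDegTwo H ⇑γ → (∀ x y : V, B (γ x) y = B x (γ y)) →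
      HodgeRiemann H B m ⇑γ → ∀ c : ℝ, 0 < c → HodgeRiemann H B m ⇑(c • γ) := by
  constructor
  · rw [isOpen_iff_mem_nhds]
    intro γ₀ h₀
    have hfin : ∀ᶠ γ : V →L[ℝ] V in nhds γ₀.1, ∀ i ∈ Finset.range ((-m).toNat + 1),
        H (-(i : ℤ)) ≠ ⊥ →
        (Even ((-(i : ℤ) - m) / 2) →
          ∀ x ∈ H (-(i : ℤ)), (⇑γ)^[i + 1] x = 0 → x ≠ 0 → 0 < B x ((⇑γ)^[i] x)) ∧
        (¬ Even ((-(i : ℤ) - m) / 2) →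
          ∀ x ∈ H (-(i : ℤ)), (⇑γ)^[i + 1] x = 0 → x ≠ 0 → B x ((⇑γ)^[i] x) < 0) := by
      rw [Filter.eventually_all_finset]
      intro i _
      by_cases hi : H (-(i : ℤ)) = ⊥
      · exact Filter.Eventually.of_forall fun γ h => absurd hi h
      have h := h₀ i hi
      by_cases he : Even ((-(i : ℤ) - m) / 2)
      · have := hr_local (H (-(i : ℤ))) B i 1 γ₀.1 (by simpa using h.1 he)
        filter_upwards [this] with γ hγ _
        exact ⟨fun _ => by simpa using hγ, fun h' => absurd he h'⟩
      · have := hr_local (H (-(i : ℤ))) B i (-1) γ₀.1 (by simpa using h.2 he)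
        filter_upwards [this] with γ hγ _
        exact ⟨fun h' => absurd h' he, fun _ => by simpa using hγ⟩
    have := (continuous_subtype_val.tendsto γ₀).eventually hfin
    filter_upwards [this] with γ hγ i hi
    refine hγ i ?_ hi
    by_contra hlt
    apply hi
    apply hmin
    simp only [Finset.mem_range] at hlt
    omega
  · intro γ _ _ h c hc i hi
    have hp : ∀ x, (⇑(c • γ))^[i + 1] x = 0 → (⇑γ)^[i + 1] x = 0 := by
      intro x hx
      rw [hr_iterate_smul] at hx
      exact (smul_eq_zero.mp hx).resolve_left (by positivity)
    have hci : 0 < c ^ i := by positivity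
    constructor
    · intro he x hx h0 hne
      rw [hr_iterate_smul, map_smul, smul_eq_mul]
      exact mul_pos hci ((h i hi).1 he x hx (hp x h0) hne)
    · intro he x hx h0 hne
      rw [hr_iterate_smul, map_smul, smul_eq_mul]
      exact mul_neg_of_pos_of_neg hci ((h i hi).2 he x hx (hp x h0) hne)
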